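/- Let f : ℝⁿ → ℝ be a real-valued function that is semi-algebraic, lower semicontinuous, and bounded on every compact subset of ℝⁿ. Then there exist m ∈ ℕ, polynomials P, Q : ℝⁿ × ℝᵐ → ℝ with Q(x,·) convex on ℝᵐ for every fixed x, and a nonempty compact convex semi-algebraic set 𝒴 ⊆ ℝᵐ, such that the optimistic value function φ_o of the associated bilevel problem satisfies φ_o = f. -/

import Mathlib

open Set

noncomputable section

/-- The lower-level argmin set `Θ(x) = {y ∈ 𝒴 : ∀ y' ∈ 𝒴, Q(x,y) ≤ Q(x,y')}`. -/
def argminSet {n m : ℕ} (Q : (Fin n → ℝ) → (Fin m → ℝ) → ℝ) (Y : Set (Fin m → ℝ))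
    (x : Fin n → ℝ) : Set (Fin m → ℝ) :=
  {y | y ∈ Y ∧ ∀ y' ∈ Y, Q x y ≤ Q x y'}

/-- Optimistic value function `φ_o(x) = inf_{y ∈ Θ(x)} P(x,y)`,
with the convention `inf ∅ = +∞`. -/
def valOpt {n m : ℕ} (P Q : (Fin n → ℝ) → (Fin m → ℝ) → ℝ) (Y : Set (Fin m → ℝ))
    (x : Fin n → ℝ) : EReal :=
  ⨅ y ∈ argminSet Q Y x, ((P x y : ℝ) : EReal)

/-- Pessimistic value function `φ_p(x) = sup_{y ∈ Θ(x)} P(x,y)`,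
with the convention `sup ∅ = -∞`. -/
def valPess {n m : ℕ} (P Q : (Fin n → ℝ) → (Fin m → ℝ) → ℝ) (Y : Set (Fin m → ℝ))
    (x : Fin n → ℝ) : EReal :=
  ⨆ y ∈ argminSet Q Y x, ((P x y : ℝ) : EReal)

/-- `P (x, y)` is a real polynomial in the joint variables `(x, y)`. -/
def IsPolyMap {n m : ℕ} (P : (Fin n → ℝ) → (Fin m → ℝ) → ℝ) : Prop :=
  ∃ p : MvPolynomial (Fin n ⊕ Fin m) ℝ,
    ∀ x y, P x y = MvPolynomial.eval (Sum.elim x y) p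

/-- Basic semi-algebraic subset of `ℝ^ι`. -/
def IsBasicSemialgebraic {ι : Type} [Fintype ι] (S : Set (ι → ℝ)) : Prop :=
  ∃ (p : MvPolynomial ι ℝ) (k : ℕ) (q : Fin k → MvPolynomial ι ℝ),
    S = {x | MvPolynomial.eval x p = 0 ∧ ∀ j, 0 < MvPolynomial.eval x (q j)}

/-- Semi-algebraic set: a finite union of basic semi-algebraic sets. -/
def IsSemialgebraic {ι : Type} [Fintype ι] (S : Set (ι → ℝ)) : Prop :=
  ∃ (N : ℕ) (T : Fin N → Set (ι → ℝ)),
    (∀ i, IsBasicSemialgebraic (T i)) ∧ S = ⋃ i, T i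

/-- Semi-algebraic real-valued function: its graph (inside `ℝ^{ι} × ℝ ≅ ℝ^{ι ⊕ Unit}`)
is semi-algebraic. -/
def IsSemialgebraicFun {ι : Type} [Fintype ι] (f : (ι → ℝ) → ℝ) : Prop :=
  IsSemialgebraic {z : (ι ⊕ Unit) → ℝ | f (z ∘ Sum.inl) = z (Sum.inr ())}

/-- Extended-real-valued semi-algebraic function: the sets where it is finite, `+∞`, `-∞`
are semi-algebraic, and the graph of its restriction to its (finite) domain is
semi-algebraic. -/
def IsERealSemialgebraicFun {ι : Type} [Fintype ι] (h : (ι → ℝ) → EReal) : Prop :=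
  IsSemialgebraic {x | ∃ r : ℝ, h x = (r : EReal)} ∧
  IsSemialgebraic {x | h x = ⊤} ∧
  IsSemialgebraic {x | h x = ⊥} ∧
  IsSemialgebraic {z : (ι ⊕ Unit) → ℝ | h (z ∘ Sum.inl) = ((z (Sum.inr ()) : ℝ) : EReal)}

/-- A (possibly unbounded) box `[a₁,b₁] × ⋯ × [aₘ,bₘ]` in `ℝ^m`, with
endpoints in `ℝ ∪ {±∞}`. -/
def IsBox {m : ℕ} (Y : Set (Fin m → ℝ)) : Prop :=
  ∃ a b : Fin m → EReal,
    Y = {y | ∀ i, a i ≤ (y i : EReal) ∧ (y i : EReal) ≤ b i}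

/-- The bounded box `[a₁,b₁] × ⋯ × [aₘ,bₘ]` with real endpoints. -/
def boundedBox {m : ℕ} (a b : Fin m → ℝ) : Set (Fin m → ℝ) :=
  {y | ∀ i, y i ∈ Set.Icc (a i) (b i)}

/-- Piecewise polynomial function: there is a finite partition of `ℝ^n` into pairwise
disjoint semi-algebraic sets on each of which `f` coincides with a polynomial. -/
def IsPiecewisePolynomial {n : ℕ} (f : (Fin n → ℝ) → ℝ) : Prop :=
  ∃ (N : ℕ) (S : Fin N → Set (Fin n → ℝ)) (p : Fin N → MvPolynomial (Fin n) ℝ),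
    (∀ i, IsSemialgebraic (S i)) ∧
    (∀ i j, i ≠ j → Disjoint (S i) (S j)) ∧
    (⋃ i, S i) = Set.univ ∧
    (∀ i, ∀ x ∈ S i, f x = MvPolynomial.eval x (p i))

open Polynomial in
theorem eval_mul_eval_pos_of_forall_ne_zero (q : ℝ[X]) {u v : ℝ}
    (h : ∀ w ∈ Set.uIcc u v, q.eval w ≠ 0) : 0 < q.eval u * q.eval v := by
  by_contra! hle
  have h0 : (0 : ℝ) ∈ Set.uIcc (q.eval u) (q.eval v) := by
    rcases mul_nonpos_iff.1 hle with ⟨h1, h2⟩ | ⟨h1, h2⟩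
    · exact Set.mem_uIcc.2 (Or.inr ⟨h2, h1⟩)
    · exact Set.mem_uIcc.2 (Or.inl ⟨h1, h2⟩)
  obtain ⟨w, hw, hw0⟩ := intermediate_value_uIcc q.continuous.continuousOn h0
  exact h w hw hw0

open Polynomial in
theorem exists_eval_sub_eq_derivative_mul (p : ℝ[X]) {a t : ℝ} (hat : a ≠ t) :
    ∃ ξ ∈ Set.uIcc a t, ξ ≠ a ∧ p.eval t - p.eval a = p.derivative.eval ξ * (t - a) := by
  rcases lt_or_gt_of_ne hat with h | h
  · obtain ⟨ξ, hξ, e⟩ := exists_hasDerivAt_eq_slope (fun x => p.eval x)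
      (fun x => p.derivative.eval x) h p.continuous.continuousOn (fun x _ => p.hasDerivAt x)
    refine ⟨ξ, Set.mem_uIcc.2 (Or.inl ⟨hξ.1.le, hξ.2.le⟩), hξ.1.ne', ?_⟩
    have : t - a ≠ 0 := by linarith
    rw [e]; field_simp
  · obtain ⟨ξ, hξ, e⟩ := exists_hasDerivAt_eq_slope (fun x => p.eval x)
      (fun x => p.derivative.eval x) h p.continuous.continuousOn (fun x _ => p.hasDerivAt x)
    refine ⟨ξ, Set.mem_uIcc.2 (Or.inr ⟨hξ.1.le, hξ.2.le⟩), hξ.2.ne, ?_⟩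
    have : a - t ≠ 0 := by linarith
    rw [e]; field_simp; ring

open Polynomial in
/-- If the derivative of `p` has no root between `a` and `t` (except perhaps `a`), then the sign of
`p` at `t` is inherited from the sign at `a` and the direction of monotonicity. -/
theorem eval_mul_pos_of_derivative_ne_zero (p : ℝ[X]) {a t σ : ℝ}
    (hd : ∀ u ∈ Set.uIcc a t, u ≠ a → p.derivative.eval u ≠ 0) (ha : 0 ≤ p.eval a * σ)
    (hdt : (a - t) * (p.derivative.eval t * σ) < 0) : 0 < p.eval t * σ := by
  have hat : a ≠ t := by rintro rfl; simp at hdt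
  obtain ⟨ξ, hξ, hξa, e⟩ := exists_eval_sub_eq_derivative_mul p hat
  have hpos : 0 < p.derivative.eval ξ * p.derivative.eval t := by
    apply eval_mul_eval_pos_of_forall_ne_zero
    intro w hw
    refine hd w ?_ ?_
    · exact Set.uIcc_subset_uIcc_right hξ hw
    · rintro rfl
      rcases Set.mem_uIcc.1 hξ with h | h <;> rcases Set.mem_uIcc.1 hw with h' | h'
      · exact hξa (le_antisymm h'.1 h.1)
      · exact hat (le_antisymm (h.1.trans h.2) h'.1)
      · exact hat (le_antisymm h'.2 (h.1.trans h.2))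
      · exact hξa (le_antisymm h.2 h'.2)
  have h2 : 0 < (p.eval t - p.eval a) * σ := by
    rw [e]
    have hne : p.derivative.eval t ≠ 0 := by rintro h0; simp [h0] at hpos
    have h3 : 0 < p.derivative.eval t * p.derivative.eval t := mul_self_pos.2 hne
    have h4 : 0 < (p.derivative.eval ξ * p.derivative.eval t) *
        -((a - t) * (p.derivative.eval t * σ)) := mul_pos hpos (by linarith)
    have : (p.derivative.eval ξ * p.derivative.eval t) *
        -((a - t) * (p.derivative.eval t * σ)) =
      (p.derivative.eval t * p.derivative.eval t) *
        (p.derivative.eval ξ * (t - a) * σ) := by ring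
    rw [this] at h4
    exact pos_of_mul_pos_right h4 h3.le
  linarith

open Polynomial in
theorem exists_anchor_right {p : ℝ[X]} {Z : Set ℝ} (hZ : Z.Finite)
    (hd : ∀ z, p.derivative.eval z = 0 → z ∈ Z) {t : ℝ} (ht : t ∉ Z) (hp : 0 < p.eval t)
    (hdt : p.derivative.eval t < 0) :
    ∃ a, t < a ∧ 0 ≤ p.eval a ∧ (a ∈ Z ∨ p.eval a = 0) ∧ ∀ u, t ≤ u → u < a → u ∉ Z := by
  have hp0 : p ≠ 0 := by rintro rfl; simp at hp
  set S : Set ℝ := {a | t < a ∧ (a ∈ Z ∨ p.eval a = 0)} with hS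
  have hfin : S.Finite := by
    refine (hZ.union (p.roots.toFinset.finite_toSet)).subset ?_
    rintro a ⟨-, h | h⟩
    · exact Or.inl h
    · right; simpa [hp0] using h
  rcases S.eq_empty_or_nonempty with hemp | hne
  · exfalso
    have hnot : ∀ u, t < u → u ∉ Z ∧ p.eval u ≠ 0 := by
      intro u hu
      have : u ∉ S := by simp [hemp]
      simp only [hS, Set.mem_ofPred_eq, not_and, not_or] at this
      exact this hu
    have hb : ∀ x, t ≤ x → |p.eval x| ≤ p.eval t := by
      intro x hx
      rcases hx.eq_or_lt with rfl | hx
      · rw [abs_of_pos hp]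
      have hpos : 0 < p.eval t * p.eval x := by
        apply eval_mul_eval_pos_of_forall_ne_zero
        intro w hw
        rw [Set.uIcc_of_le hx.le] at hw
        rcases hw.1.eq_or_lt with rfl | h
        · exact hp.ne'
        · exact (hnot w h).2
      have hpx : 0 < p.eval x := pos_of_mul_pos_right hpos hp.le
      rw [abs_of_pos hpx]
      obtain ⟨ξ, hξ, hξt, e⟩ := exists_eval_sub_eq_derivative_mul p hx.ne
      rw [Set.uIcc_of_le hx.le] at hξ
      have hpos' : 0 < p.derivative.eval t * p.derivative.eval ξ := by
        apply eval_mul_eval_pos_of_forall_ne_zero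
        intro w hw
        rw [Set.uIcc_of_le hξ.1] at hw
        rcases hw.1.eq_or_lt with rfl | h
        · exact hdt.ne
        · exact fun h0 => (hnot w h).1 (hd w h0)
      have : p.derivative.eval ξ < 0 := by
        by_contra! h
        nlinarith
      nlinarith
    have : p.degree ≤ 0 := by
      rw [← Polynomial.isBoundedUnder_abs_atTop_iff]
      refine ⟨p.eval t, ?_⟩
      rw [Filter.eventually_map]
      filter_upwards [Filter.eventually_ge_atTop t] with x hx using hb x hx
    rw [Polynomial.eq_C_of_degree_le_zero this] at hdt
    simp at hdt
  · obtain ⟨a, ha, hmin⟩ := Set.exists_min_image S id hfin hne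
    simp only [id] at hmin
    refine ⟨a, ha.1, ?_, ha.2, ?_⟩
    · by_contra! hneg
      obtain ⟨w, hw, hw0⟩ : (0 : ℝ) ∈ (fun x => p.eval x) '' Set.Ioo t a :=
        intermediate_value_Ioo' ha.1.le p.continuous.continuousOn ⟨hneg, hp⟩
      exact absurd (hmin w ⟨hw.1, Or.inr hw0⟩) (not_le.2 hw.2)
    · intro u hu hua huZ
      rcases hu.eq_or_lt with rfl | hu
      · exact ht huZ
      · exact absurd (hmin u ⟨hu, Or.inl huZ⟩) (not_le.2 hua)

open Polynomial in
/-- Away from the finite set `Z` containing the critical points of `p`, a nonzero value of `p` is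
explained by a neighbouring point which is either in `Z` or a root of `p`. -/
theorem exists_anchor {p : ℝ[X]} {Z : Set ℝ} (hZ : Z.Finite)
    (hd : ∀ z, p.derivative.eval z = 0 → z ∈ Z) {t : ℝ} (ht : t ∉ Z) (hp : p.eval t ≠ 0) :
    ∃ a, (a - t) * (p.derivative.eval t * p.eval t) < 0 ∧ 0 ≤ p.eval a * p.eval t ∧
      (a ∈ Z ∨ p.eval a = 0) ∧ ∀ u ∈ Set.uIcc a t, u ≠ a → u ∉ Z := by
  have hdt : p.derivative.eval t ≠ 0 := fun h => ht (hd t h)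
  have key : ∀ (p : ℝ[X]), (∀ z, p.derivative.eval z = 0 → z ∈ Z) → 0 < p.eval t →
      p.derivative.eval t ≠ 0 →
      ∃ a, (a - t) * p.derivative.eval t < 0 ∧ 0 ≤ p.eval a ∧
        (a ∈ Z ∨ p.eval a = 0) ∧ ∀ u ∈ Set.uIcc a t, u ≠ a → u ∉ Z := by
    intro p hd hp hdt
    rcases lt_or_gt_of_ne hdt with hneg | hpos
    · obtain ⟨a, hta, hpa, haZ, hu⟩ := exists_anchor_right hZ hd ht hp hneg
      refine ⟨a, mul_neg_of_pos_of_neg (by linarith) hneg, hpa, haZ, fun u hu1 hu2 => ?_⟩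
      rw [Set.uIcc_of_ge hta.le] at hu1
      exact hu u hu1.1 (lt_of_le_of_ne hu1.2 hu2)
    · have hder : ∀ z, (p.comp (-X)).derivative.eval z = - p.derivative.eval (-z) := by
        intro z; simp [Polynomial.derivative_comp]
      have hev : ∀ z, (p.comp (-X)).eval z = p.eval (-z) := by
        intro z; simp
      obtain ⟨a, hta, hpa, haZ, hu⟩ := exists_anchor_right (p := p.comp (-X)) (Z := -Z) (t := -t)
        (hZ.neg) (fun z hz => by rw [hder] at hz; exact hd _ (by linarith))
        (by simpa using ht) (by rw [hev]; simpa using hp) (by rw [hder]; simpa using hpos)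
      rw [hev] at hpa haZ
      refine ⟨-a, mul_neg_of_neg_of_pos (by linarith) hpos, hpa, haZ, fun u hu1 hu2 => ?_⟩
      rw [Set.uIcc_of_le (by linarith)] at hu1
      have := hu (-u) (by linarith [hu1.2])
        (lt_of_le_of_ne (by linarith [hu1.1]) (fun h => hu2 (by linarith)))
      simpa using this
  rcases lt_or_gt_of_ne hp with hneg | hpos
  · obtain ⟨a, h1, h2, h3, h4⟩ := key (-p) (by simpa using hd) (by simpa using hneg)
      (by simpa using hdt)
    simp only [derivative_neg, eval_neg] at h1 h2 h3
    refine ⟨a, ?_, ?_, by simpa using h3, h4⟩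
    · nlinarith
    · nlinarith
  · obtain ⟨a, h1, h2, h3, h4⟩ := key p hd hpos hdt
    exact ⟨a, by nlinarith, by positivity, h3, h4⟩

theorem exists_orderIso_bump {a b c c' : ℝ} (hac : a < c) (hcb : c < b) (hac' : a < c')
    (hcb' : c' < b) : ∃ β : ℝ ≃o ℝ, β c = c' ∧ ∀ t, t ∉ Set.Ioo a b → β t = t := by
  set T : ℝ → ℝ := fun t => max 0 (min ((t - a) / (c - a)) ((b - t) / (b - c))) with hT
  have h1 : 0 < c - a := by linarith
  have h2 : 0 < b - c := by linarith
  set g : ℝ → ℝ := fun t => t + (c' - c) * T t with hg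
  have hTout : ∀ t, t ∉ Set.Ioo a b → T t = 0 := by
    intro t ht
    apply max_eq_left
    rcases le_or_gt t a with h | h
    · exact (min_le_left _ _).trans (div_nonpos_of_nonpos_of_nonneg (by linarith) h1.le)
    · have : b ≤ t := by
        by_contra! hh
        exact ht ⟨h, hh⟩
      exact (min_le_right _ _).trans (div_nonpos_of_nonpos_of_nonneg (by linarith) h2.le)
  have hgout : ∀ t, t ∉ Set.Ioo a b → g t = t := by
    intro t ht; simp [hg, hTout t ht]
  have hmono : StrictMono g := by
    intro u v huv
    have hA : (u - a) / (c - a) ≤ (v - a) / (c - a) := by gcongr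
    have hB : (b - v) / (b - c) ≤ (b - u) / (b - c) := by gcongr
    have hA' : (v - a) / (c - a) = (u - a) / (c - a) + (v - u) / (c - a) := by
      field_simp; ring
    have hB' : (b - u) / (b - c) = (b - v) / (b - c) + (v - u) / (b - c) := by
      field_simp; ring
    have p1 : 0 < (v - u) / (c - a) := div_pos (by linarith) h1
    have p2 : 0 < (v - u) / (b - c) := div_pos (by linarith) h2
    have e1 : T v ≤ T u + (v - u) / (c - a) := by
      simp only [hT]
      apply max_le
      · have := le_max_left 0 (min ((u - a) / (c - a)) ((b - u) / (b - c)))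
        linarith
      · rw [← sub_le_iff_le_add]
        apply le_max_of_le_right
        apply le_min
        · linarith [min_le_left ((v - a) / (c - a)) ((b - v) / (b - c))]
        · linarith [min_le_right ((v - a) / (c - a)) ((b - v) / (b - c))]
    have e2 : T u ≤ T v + (v - u) / (b - c) := by
      simp only [hT]
      apply max_le
      · have := le_max_left 0 (min ((v - a) / (c - a)) ((b - v) / (b - c)))
        linarith
      · rw [← sub_le_iff_le_add]
        apply le_max_of_le_right
        apply le_min
        · linarith [min_le_left ((u - a) / (c - a)) ((b - u) / (b - c))]
        · linarith [min_le_right ((u - a) / (c - a)) ((b - u) / (b - c))]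
    simp only [hg]
    rcases le_total c c' with hc | hc
    · have : (c' - c) * ((v - u) / (b - c)) < v - u := by
        rw [← mul_div_assoc, div_lt_iff₀ h2]
        nlinarith
      nlinarith
    · have : (c - c') * ((v - u) / (c - a)) < v - u := by
        rw [← mul_div_assoc, div_lt_iff₀ h1]
        nlinarith
      nlinarith
  have hcont : Continuous g := by
    simp only [hg, hT]; fun_prop
  have hsurj : Function.Surjective g := by
    apply hcont.surjective
    · refine Filter.tendsto_id.congr' ?_
      filter_upwards [Filter.eventually_ge_atTop b] with t ht
      exact (hgout t (fun h => absurd h.2 (not_lt.2 ht))).symm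
    · refine Filter.tendsto_id.congr' ?_
      filter_upwards [Filter.eventually_le_atBot a] with t ht
      exact (hgout t (fun h => absurd h.1 (not_lt.2 ht))).symm
  refine ⟨hmono.orderIsoOfSurjective g hsurj, ?_, fun t ht => hgout t ht⟩
  have : T c = 1 := by
    simp only [hT]
    rw [div_self h1.ne', div_self h2.ne']; simp
  show g c = c'
  simp [hg, this]

open SignType in
theorem mul_neg_of_sign_eq {a b c d σ : ℝ} (h1 : sign a = sign b) (h2 : sign c = sign d)
    (h : a * (c * σ) < 0) : b * (d * σ) < 0 := by
  rw [← sign_eq_neg_one_iff] at h ⊢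
  rw [← h, sign_mul, sign_mul, sign_mul, sign_mul, h1, h2]

open SignType in
theorem mul_nonneg_of_sign_eq {a b σ : ℝ} (h1 : sign a = sign b) (h : 0 ≤ a * σ) : 0 ≤ b * σ := by
  rw [← sign_nonneg_iff] at h ⊢
  rwa [sign_mul, ← h1, ← sign_mul]

theorem sign_eq_of_mul_pos {a b : ℝ} (h : 0 < a * b) : SignType.sign a = SignType.sign b := by
  rcases mul_pos_iff.1 h with ⟨h1, h2⟩ | ⟨h1, h2⟩
  · rw [sign_pos h1, sign_pos h2]
  · rw [sign_neg h1, sign_neg h2]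

theorem OrderIso.sign_sub (ψ : ℝ ≃o ℝ) (a b : ℝ) :
    SignType.sign (ψ a - ψ b) = SignType.sign (a - b) := by
  rcases lt_trichotomy a b with h | rfl | h
  · rw [sign_neg (sub_neg.2 h), sign_neg (sub_neg.2 (ψ.lt_iff_lt.2 h))]
  · simp
  · rw [sign_pos (sub_pos.2 h), sign_pos (sub_pos.2 (ψ.lt_iff_lt.2 h))]

open Polynomial in
/-- Changing the order isomorphism away from the roots does not affect the sign diagram. -/
theorem sign_eval_eq_of_eqOn {q q' : ℝ[X]} {φ ψ : ℝ ≃o ℝ} {Z : Set ℝ}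
    (hφ : ∀ t, SignType.sign (q.eval t) = SignType.sign (q'.eval (φ t)))
    (hZ : ∀ z, q.eval z = 0 → z ∈ Z) (hψ : ∀ z ∈ Z, ψ z = φ z) (t : ℝ) :
    SignType.sign (q.eval t) = SignType.sign (q'.eval (ψ t)) := by
  by_cases ht : t ∈ Z
  · rw [hψ t ht, hφ]
  rw [hφ]
  apply sign_eq_of_mul_pos
  apply eval_mul_eval_pos_of_forall_ne_zero
  intro w hw h0
  obtain ⟨z, rfl⟩ := φ.surjective w
  have hzZ : z ∈ Z := by
    apply hZ
    rw [← sign_eq_zero_iff, hφ, h0, sign_zero]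
  have hzt : z = t := by
    rcases Set.mem_uIcc.1 hw with h | h
    · apply le_antisymm
      · rw [← hψ z hzZ] at h; exact ψ.le_iff_le.1 h.2
      · exact φ.le_iff_le.1 h.1
    · apply le_antisymm
      · exact φ.le_iff_le.1 h.2
      · rw [← hψ z hzZ] at h; exact ψ.le_iff_le.1 h.1
  exact ht (hzt ▸ hzZ)

open Polynomial in
/-- The induction step of Hörmander's sign-diagram argument: the order isomorphism matching the sign
diagrams of the derivatives, and the signs of `p` and `p'` on a finite set `Z` containing the
critical points, can be modified off `Z` to match the sign diagrams of `p` and `p'`. -/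
theorem exists_orderIso_sign_eval_eq {p p' : ℝ[X]} {Z : Set ℝ} (hZ : Z.Finite) {φ : ℝ ≃o ℝ}
    (hdZ : ∀ z, p.derivative.eval z = 0 → z ∈ Z)
    (hd : ∀ t, SignType.sign (p.derivative.eval t) = SignType.sign (p'.derivative.eval (φ t)))
    (hp : ∀ z ∈ Z, SignType.sign (p.eval z) = SignType.sign (p'.eval (φ z))) :
    ∃ ψ : ℝ ≃o ℝ, (∀ z ∈ Z, ψ z = φ z) ∧
      ∀ t, SignType.sign (p.eval t) = SignType.sign (p'.eval (ψ t)) := by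
  have hp0 : p ≠ 0 := by
    rintro rfl
    exact Set.infinite_univ (hZ.subset fun z _ => hdZ z (by simp))
  have hroots : ∀ T : Finset ℝ, (∀ c ∈ T, p.eval c = 0) →
      ∃ ψ : ℝ ≃o ℝ, (∀ z ∈ Z, ψ z = φ z) ∧ ∀ c ∈ T, p'.eval (ψ c) = 0 := by
    intro T
    induction T using Finset.induction_on with
    | empty => intro _; exact ⟨φ, fun _ _ => rfl, by simp⟩
    | insert c T hcT ih =>
      intro hT
      obtain ⟨ψ, hψZ, hψT⟩ := ih fun d hd => hT d (Finset.mem_insert_of_mem hd)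
      have hpc : p.eval c = 0 := hT c (Finset.mem_insert_self _ _)
      by_cases hc0 : p'.eval (ψ c) = 0
      · refine ⟨ψ, hψZ, ?_⟩
        intro d hd
        rcases Finset.mem_insert.1 hd with rfl | hd
        · exact hc0
        · exact hψT d hd
      have hcZ : c ∉ Z := fun h => hc0 <| by
        rw [hψZ c h, ← sign_eq_zero_iff, ← hp c h, hpc, sign_zero]
      have hψd := sign_eval_eq_of_eqOn hd hdZ hψZ
      have hZ' : (ψ '' Z).Finite := hZ.image _
      have hdZ' : ∀ z, p'.derivative.eval z = 0 → z ∈ ψ '' Z := by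
        intro z hz
        obtain ⟨y, rfl⟩ := ψ.surjective z
        refine ⟨y, hdZ y ?_, rfl⟩
        rw [← sign_eq_zero_iff, hψd, hz, sign_zero]
      have hcZ' : ψ c ∉ ψ '' Z := by
        rintro ⟨z, hz, e⟩
        exact hcZ (ψ.injective e ▸ hz)
      obtain ⟨a', h1, h2, h3, h4⟩ := exists_anchor hZ' hdZ' hcZ' hc0
      have ha' : a' ∉ ψ '' Z := by
        rintro ⟨a, haZ, rfl⟩
        have : 0 < p.eval c * p'.eval (ψ c) := by
          apply eval_mul_pos_of_derivative_ne_zero p (a := a)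
          · intro u hu hua h0
            refine h4 (ψ u) ?_ (fun e => hua (ψ.injective e)) ⟨u, hdZ u h0, rfl⟩
            rcases Set.mem_uIcc.1 hu with h | h
            · exact Set.mem_uIcc.2 (Or.inl ⟨ψ.le_iff_le.2 h.1, ψ.le_iff_le.2 h.2⟩)
            · exact Set.mem_uIcc.2 (Or.inr ⟨ψ.le_iff_le.2 h.1, ψ.le_iff_le.2 h.2⟩)
          · refine mul_nonneg_of_sign_eq ?_ h2
            rw [hp a haZ, hψZ a haZ]
          · exact mul_neg_of_sign_eq (ψ.sign_sub a c) (hψd c).symm h1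
        simp [hpc] at this
      have hpa' : p'.eval a' = 0 := h3.resolve_left ha'
      have h5 : ∀ u ∈ Set.uIcc a' (ψ c), u ∉ ψ '' Z := by
        intro u hu
        by_cases h : u = a'
        · exact h ▸ ha'
        · exact h4 u hu h
      have hopen : IsOpen (ψ '' Z)ᶜ := hZ'.isClosed.isOpen_compl
      obtain ⟨α, hα, hαZ⟩ := exists_Ioc_subset_of_mem_nhds
        (hopen.mem_nhds (h5 _ ⟨le_rfl, inf_le_sup⟩)) ⟨_, sub_one_lt _⟩
      obtain ⟨β, hβ, hβZ⟩ := exists_Ico_subset_of_mem_nhds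
        (hopen.mem_nhds (h5 _ ⟨inf_le_sup, le_rfl⟩)) ⟨_, lt_add_one _⟩
      have hIoo : ∀ u ∈ Set.Ioo α β, u ∉ ψ '' Z := by
        intro u hu
        rcases le_or_gt u (a' ⊓ ψ c) with h | h
        · exact hαZ ⟨hu.1, h⟩
        rcases le_or_gt (a' ⊔ ψ c) u with h' | h'
        · exact hβZ ⟨h', hu.2⟩
        · exact h5 u ⟨h.le, h'.le⟩
      obtain ⟨κ, hκ, hκout⟩ := exists_orderIso_bump (a := α) (b := β) (c := ψ c) (c' := a')
        (hα.trans_le inf_le_right) (lt_of_le_of_lt le_sup_right hβ)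
        (hα.trans_le inf_le_left) (lt_of_le_of_lt le_sup_left hβ)
      refine ⟨ψ.trans κ, fun z hz => ?_, fun d hd => ?_⟩
      · rw [OrderIso.trans_apply, hκout _ fun h => hIoo _ h ⟨z, hz, rfl⟩, hψZ z hz]
      · rw [OrderIso.trans_apply]
        rcases Finset.mem_insert.1 hd with rfl | hdT
        · rw [hκ, hpa']
        by_cases hψd : ψ d ∈ Set.Ioo α β
        · have hcd : c = d := by
            by_contra hne
            obtain ⟨ξ, hξ, -, e⟩ := exists_eval_sub_eq_derivative_mul p hne
            rw [hpc, hT d hd, sub_self, eq_comm, mul_eq_zero] at e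
            have hξ0 := e.resolve_right (sub_ne_zero.2 (Ne.symm hne))
            have hψc : ψ c ∈ Set.Ioo α β :=
              ⟨hα.trans_le inf_le_right, lt_of_le_of_lt le_sup_right hβ⟩
            refine hIoo (ψ ξ) ?_ ⟨ξ, hdZ ξ hξ0, rfl⟩
            rcases Set.mem_uIcc.1 hξ with h | h
            · exact ⟨hψc.1.trans_le (ψ.le_iff_le.2 h.1), (ψ.le_iff_le.2 h.2).trans_lt hψd.2⟩
            · exact ⟨hψd.1.trans_le (ψ.le_iff_le.2 h.1), (ψ.le_iff_le.2 h.2).trans_lt hψc.2⟩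
          exact absurd (hcd ▸ hdT) hcT
        · rw [hκout _ hψd, hψT d hdT]
  obtain ⟨ψ, hψZ, hψr⟩ := hroots p.roots.toFinset (by simp [hp0])
  refine ⟨ψ, hψZ, fun t => ?_⟩
  have hψd := sign_eval_eq_of_eqOn hd hdZ hψZ
  have hr : ∀ c, p.eval c = 0 → p'.eval (ψ c) = 0 := fun c hc => hψr c (by simpa [hp0] using hc)
  by_cases htZ : t ∈ Z
  · rw [hp t htZ, hψZ t htZ]
  by_cases ht0 : p.eval t = 0
  · rw [ht0, hr t ht0]
  obtain ⟨a, h1, h2, h3, h4⟩ := exists_anchor hZ hdZ htZ ht0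
  refine (sign_eq_of_mul_pos ?_).symm
  apply eval_mul_pos_of_derivative_ne_zero p' (a := ψ a)
  · intro u hu hua h0
    obtain ⟨y, rfl⟩ := ψ.surjective u
    refine h4 y ?_ (fun e => hua (e ▸ rfl)) (hdZ y ?_)
    · rcases Set.mem_uIcc.1 hu with h | h
      · exact Set.mem_uIcc.2 (Or.inl ⟨ψ.le_iff_le.1 h.1, ψ.le_iff_le.1 h.2⟩)
      · exact Set.mem_uIcc.2 (Or.inr ⟨ψ.le_iff_le.1 h.1, ψ.le_iff_le.1 h.2⟩)
    · rw [← sign_eq_zero_iff, hψd, h0, sign_zero]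
  · rcases h3 with h3 | h3
    · refine mul_nonneg_of_sign_eq ?_ h2
      rw [hp a h3, hψZ a h3]
    · simp [hr a h3]
  · exact mul_neg_of_sign_eq (ψ.sign_sub a t).symm (hψd t) h1

open Polynomial in
theorem exists_pseudo_remainder {A : Type*} [CommRing A] [IsDomain A] {q : A[X]} (hq : q ≠ 0)
    (p : A[X]) :
    ∃ (k : ℕ) (s r : A[X]), C (q.leadingCoeff ^ k) * p = q * s + r ∧ r.degree < q.degree := by
  induction hd : p.degree using WellFoundedLT.induction generalizing p with
  | ind d ih =>
    by_cases hpq : p.degree < q.degree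
    · exact ⟨0, 0, p, by simp, hpq⟩
    have hp : p ≠ 0 := by
      rintro rfl
      exact hpq (by simpa [bot_lt_iff_ne_bot] using hq)
    have hle : q.natDegree ≤ p.natDegree := natDegree_le_natDegree (not_lt.1 hpq)
    have hql : q.leadingCoeff ≠ 0 := leadingCoeff_ne_zero.2 hq
    have hpl : p.leadingCoeff ≠ 0 := leadingCoeff_ne_zero.2 hp
    set m : A[X] := C p.leadingCoeff * X ^ (p.natDegree - q.natDegree) with hm
    have hlt : (C q.leadingCoeff * p - q * m).degree < p.degree := by
      have h1 : (C q.leadingCoeff * p).degree = p.degree := by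
        rw [degree_mul, degree_C hql, zero_add]
      have h2 : (q * m).degree = p.degree := by
        rw [hm, degree_mul, degree_C_mul_X_pow _ hpl, degree_eq_natDegree hq,
          degree_eq_natDegree hp]
        norm_cast
        omega
      rw [← h1]
      apply degree_sub_lt_left
      · rw [h1, h2]
      · exact mul_ne_zero (C_ne_zero.2 hql) hp
      · simp [hm, leadingCoeff_mul]
    obtain ⟨k, s, r, e, hr⟩ := ih _ (hd ▸ hlt) _ rfl
    refine ⟨k + 1, s + C (q.leadingCoeff ^ k) * m, r, ?_, hr⟩
    have : C (q.leadingCoeff ^ (k + 1)) * p =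
      C (q.leadingCoeff ^ k) * (C q.leadingCoeff * p - q * m)
        + q * (C (q.leadingCoeff ^ k) * m) := by
      rw [pow_succ, C_mul]; ring
    rw [this, e]; ring

open Polynomial in
theorem exists_pseudo_remainder_even {A : Type*} [CommRing A] [IsDomain A] (p q : A[X]) :
    ∃ r : A[X], (q = 0 → r = 0) ∧ (q ≠ 0 → r.degree < q.degree) ∧
      ∀ (e : A →+* ℝ), e q.leadingCoeff ≠ 0 → ∀ z, (q.map e).eval z = 0 →
        SignType.sign ((p.map e).eval z) = SignType.sign ((r.map e).eval z) := by
  by_cases hq : q = 0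
  · exact ⟨0, fun _ => rfl, fun h => absurd hq h, fun e he => absurd (by simp [hq]) he⟩
  obtain ⟨k, s, r, h, hr⟩ := exists_pseudo_remainder hq p
  refine ⟨C (q.leadingCoeff ^ k) * r, fun h => absurd h hq, fun _ => ?_, fun e he z hz => ?_⟩
  · have hql : q.leadingCoeff ^ k ≠ 0 := pow_ne_zero _ (leadingCoeff_ne_zero.2 hq)
    rwa [degree_mul, degree_C hql, zero_add]
  · have h2 := congrArg (fun f => (f.map e).eval z) h
    simp only [Polynomial.map_mul, Polynomial.map_add, map_C, eval_mul, eval_add, eval_C, hz,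
      zero_mul, zero_add] at h2
    have hk : e (q.leadingCoeff ^ k) ≠ 0 := by
      rw [map_pow]; exact pow_ne_zero _ he
    simp only [Polynomial.map_mul, map_C, eval_mul, eval_C, ← h2]
    rw [← mul_assoc, sign_mul, sign_pos (mul_self_pos.2 hk), one_mul]

open Polynomial in
theorem map_leadingCoeff_derivative_ne_zero {A : Type*} [CommRing A] {p : A[X]}
    (hp : 0 < p.natDegree) {e : A →+* ℝ} (he : e p.leadingCoeff ≠ 0) :
    e p.derivative.leadingCoeff ≠ 0 := by
  obtain ⟨n, hn⟩ : ∃ n, p.natDegree = n + 1 := ⟨p.natDegree - 1, by omega⟩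
  have h1 : e (p.derivative.coeff n) ≠ 0 := by
    rw [coeff_derivative, ← hn, map_mul]
    refine mul_ne_zero he ?_
    rw [map_add, map_natCast, map_one]
    positivity
  have h2 : p.derivative.natDegree = n := by
    apply natDegree_eq_of_le_of_coeff_ne_zero
    · exact (natDegree_derivative_le p).trans (by omega)
    · intro h; simp [h] at h1
  rwa [leadingCoeff, h2]

open Polynomial in
/-- The sign diagram of a finite family of univariate polynomials with parametric coefficients is
determined by the signs of finitely many elements of the coefficient ring. -/
theorem exists_finset_sign_diagram {A : Type*} [CommRing A] [IsDomain A] (L : Multiset A[X]) :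
    ∃ B : Finset A, ∀ e e' : A →+* ℝ,
      (∀ b ∈ B, SignType.sign (e b) = SignType.sign (e' b)) →
      ∃ φ : ℝ ≃o ℝ, ∀ p ∈ L, ∀ t,
        SignType.sign ((p.map e).eval t) = SignType.sign ((p.map e').eval (φ t)) := by
  classical
  induction L using (InvImage.wf (fun L : Multiset A[X] => L.map degree)
    Multiset.wellFounded_isDershowitzMannaLT).induction with
  | _ L ih =>
  by_cases hconst : ∀ p ∈ L, p.degree ≤ 0
  · refine ⟨(L.map (fun p => p.coeff 0)).toFinset, fun e e' h => ⟨OrderIso.refl ℝ, ?_⟩⟩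
    intro p hp t
    rw [eq_C_of_degree_le_zero (hconst p hp)]
    simp only [map_C, eval_C]
    exact h _ (Multiset.mem_toFinset.2 (Multiset.mem_map_of_mem _ hp))
  push Not at hconst
  obtain ⟨p, hpL, hpmax⟩ : ∃ p ∈ L, ∀ q ∈ L, q.degree ≤ p.degree := by
    obtain ⟨p₀, hp₀, -⟩ := hconst
    obtain ⟨p, hp, h⟩ := L.toFinset.exists_max_image degree ⟨p₀, Multiset.mem_toFinset.2 hp₀⟩
    exact ⟨p, Multiset.mem_toFinset.1 hp, fun q hq => h q (Multiset.mem_toFinset.2 hq)⟩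
  have hpdeg : 0 < p.degree := by
    obtain ⟨p₀, hp₀, h⟩ := hconst
    exact h.trans_le (hpmax _ hp₀)
  have hpnat : 0 < p.natDegree := natDegree_pos_iff_degree_pos.2 hpdeg
  have hp0 : p ≠ 0 := by rintro rfl; simp at hpdeg
  obtain ⟨L', rfl⟩ := Multiset.exists_cons_of_mem hpL
  choose R hR0 hRdeg hR using exists_pseudo_remainder_even p
  have hp'deg : p.derivative.degree < p.degree := degree_derivative_lt hp0
  have hRlt : ∀ q ∈ p.derivative ::ₘ L', (R q).degree < p.degree := by
    intro q hq
    by_cases hq0 : q = 0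
    · rw [hR0 q hq0, degree_zero, bot_lt_iff_ne_bot]
      simpa using hp0
    refine (hRdeg q hq0).trans_le ?_
    rcases Multiset.mem_cons.1 hq with rfl | hq
    · exact hp'deg.le
    · exact hpmax q (Multiset.mem_cons_of_mem hq)
  obtain ⟨BF, hBF⟩ := ih (L' + (p.derivative ::ₘ (p.derivative ::ₘ L').map R)) <| by
    refine ⟨L'.map degree, (p.derivative ::ₘ (p.derivative ::ₘ L').map R).map degree,
      {p.degree}, by simp, by simp, ?_, ?_⟩
    · rw [add_comm, Multiset.singleton_add]
      exact Multiset.map_cons _ _ _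
    · intro y hy
      refine ⟨p.degree, by simp, ?_⟩
      obtain ⟨r, hr, rfl⟩ := Multiset.mem_map.1 hy
      rcases Multiset.mem_cons.1 hr with rfl | hr
      · exact hp'deg
      · obtain ⟨q, hq, rfl⟩ := Multiset.mem_map.1 hr
        exact hRlt q hq
  have hE : ∀ q, ∃ Bq : Finset A, q ∈ p ::ₘ L' → q ≠ 0 → ∀ e e' : A →+* ℝ,
      (∀ b ∈ Bq, SignType.sign (e b) = SignType.sign (e' b)) →
      ∃ φ : ℝ ≃o ℝ, ∀ r ∈ q.eraseLead ::ₘ (p ::ₘ L').erase q, ∀ t,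
        SignType.sign ((r.map e).eval t) = SignType.sign ((r.map e').eval (φ t)) := by
    intro q
    by_cases hq : q ∈ p ::ₘ L' ∧ q ≠ 0
    · obtain ⟨Bq, h⟩ := ih (q.eraseLead ::ₘ (p ::ₘ L').erase q) <| by
        refine ⟨((p ::ₘ L').erase q).map degree, {q.eraseLead.degree}, {q.degree}, by simp, ?_, ?_,
          ?_⟩
        · rw [add_comm, Multiset.singleton_add]
          exact Multiset.map_cons _ _ _
        · rw [add_comm, Multiset.singleton_add, ← Multiset.map_cons, Multiset.cons_erase hq.1]
        · simpa using degree_eraseLead_lt hq.2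
      exact ⟨Bq, fun _ _ => h⟩
    · exact ⟨∅, fun h1 h2 => absurd ⟨h1, h2⟩ hq⟩
  choose BE hBE using hE
  refine ⟨((p ::ₘ L').map leadingCoeff).toFinset ∪ BF ∪ (p ::ₘ L').toFinset.biUnion BE,
    fun e e' hB => ?_⟩
  have hlc : ∀ q ∈ p ::ₘ L', SignType.sign (e q.leadingCoeff) = SignType.sign (e' q.leadingCoeff) :=
    fun q hq => hB _ <| by
      simp only [Finset.mem_union]
      exact Or.inl (Or.inl (Multiset.mem_toFinset.2 (Multiset.mem_map_of_mem _ hq)))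
  by_cases hvan : ∃ q ∈ p ::ₘ L', q ≠ 0 ∧ e q.leadingCoeff = 0
  · obtain ⟨q, hq, hq0, he⟩ := hvan
    have he' : e' q.leadingCoeff = 0 := by
      rw [← sign_eq_zero_iff, ← hlc q hq, he, sign_zero]
    obtain ⟨φ, hφ⟩ := hBE q hq hq0 e e' fun b hb => hB _ <| by
      simp only [Finset.mem_union, Finset.mem_biUnion]
      exact Or.inr ⟨q, Multiset.mem_toFinset.2 hq, hb⟩
    refine ⟨φ, fun r hr t => ?_⟩
    by_cases hrq : r = q
    · subst hrq
      have key : ∀ f : A →+* ℝ, f r.leadingCoeff = 0 → r.map f = r.eraseLead.map f := by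
        intro f hf
        have h := congrArg (Polynomial.map f) (eraseLead_add_C_mul_X_pow r)
        rw [Polynomial.map_add, Polynomial.map_mul, map_C, hf, C_0, zero_mul, add_zero] at h
        exact h.symm
      rw [key e he, key e' he']
      exact hφ _ (Multiset.mem_cons_self _ _) t
    · exact hφ _ (Multiset.mem_cons_of_mem ((Multiset.mem_erase_of_ne hrq).2 hr)) t
  push Not at hvan
  obtain ⟨φ, hφ⟩ := hBF e e' fun b hb => hB _ <| by
    simp only [Finset.mem_union]
    exact Or.inl (Or.inr hb)
  have hvan' : ∀ q ∈ p ::ₘ L', q ≠ 0 → e' q.leadingCoeff ≠ 0 := by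
    intro q hq hq0 h
    refine hvan q hq hq0 ?_
    rw [← sign_eq_zero_iff, hlc q hq, h, sign_zero]
  have hep := hvan p hpL hp0
  have hlcne : ∀ q ∈ p.derivative ::ₘ L', q ≠ 0 →
      e q.leadingCoeff ≠ 0 ∧ e' q.leadingCoeff ≠ 0 := by
    intro q hq hq0
    rcases Multiset.mem_cons.1 hq with rfl | hq
    · exact ⟨map_leadingCoeff_derivative_ne_zero hpnat hep,
        map_leadingCoeff_derivative_ne_zero hpnat (hvan' p hpL hp0)⟩
    · exact ⟨hvan q (Multiset.mem_cons_of_mem hq) hq0, hvan' q (Multiset.mem_cons_of_mem hq) hq0⟩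
  have hφL : ∀ q ∈ p.derivative ::ₘ L', ∀ t,
      SignType.sign ((q.map e).eval t) = SignType.sign ((q.map e').eval (φ t)) := by
    intro q hq
    refine hφ q ?_
    rcases Multiset.mem_cons.1 hq with rfl | hq
    · exact Multiset.mem_add.2 (Or.inr (Multiset.mem_cons_self _ _))
    · exact Multiset.mem_add.2 (Or.inl hq)
  set Z : Set ℝ := ⋃ q ∈ (p.derivative ::ₘ L').toFinset,
    ((q.map e).roots.toFinset : Set ℝ) with hZdef
  have hZ : Z.Finite := Set.Finite.biUnion (Finset.finite_toSet _) fun q _ => Finset.finite_toSet _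
  have hmemZ : ∀ q ∈ p.derivative ::ₘ L', q.map e ≠ 0 → ∀ z, (q.map e).eval z = 0 → z ∈ Z := by
    intro q hq hq0 z hz
    simp only [hZdef, Set.mem_iUnion]
    exact ⟨q, Multiset.mem_toFinset.2 hq, by simpa [hq0] using hz⟩
  have hp'e : p.derivative.map e ≠ 0 := by
    rw [← derivative_map]
    intro h
    have := derivative_eq_zero.1 h
    rw [natDegree_map_of_leadingCoeff_ne_zero _ hep] at this
    omega
  obtain ⟨ψ, hψZ, hψ⟩ := exists_orderIso_sign_eval_eq (p := p.map e) (p' := p.map e') hZ (φ := φ)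
    (by rw [derivative_map]; exact hmemZ _ (Multiset.mem_cons_self _ _) hp'e)
    (by simp only [derivative_map]; exact hφL _ (Multiset.mem_cons_self _ _))
    (by
      intro z hz
      simp only [hZdef, Set.mem_iUnion] at hz
      obtain ⟨q, hq, hz⟩ := hz
      rw [Multiset.mem_toFinset] at hq
      have hqe : q.map e ≠ 0 := by rintro h; simp [h] at hz
      have hz0 : (q.map e).eval z = 0 := by simpa [hqe] using hz
      have hq0 : q ≠ 0 := by rintro rfl; simp at hqe
      have hz0' : (q.map e').eval (φ z) = 0 := by
        rw [← sign_eq_zero_iff, ← hφL q hq, hz0, sign_zero]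
      rw [hR q e (hlcne q hq hq0).1 z hz0, hR q e' (hlcne q hq hq0).2 _ hz0']
      exact hφ _ (Multiset.mem_add.2 (Or.inr (Multiset.mem_cons_of_mem
        (Multiset.mem_map_of_mem _ hq)))) z)
  refine ⟨ψ, fun q hq t => ?_⟩
  rcases Multiset.mem_cons.1 hq with rfl | hq
  · exact hψ t
  have hq' : q ∈ p.derivative ::ₘ L' := Multiset.mem_cons_of_mem hq
  by_cases hqe : q.map e = 0
  · obtain ⟨s, hs⟩ := φ.surjective (ψ t)
    rw [← hs, ← hφL q hq', hqe]
    simp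
  · exact sign_eval_eq_of_eqOn (hφL q hq') (hmemZ q hq' hqe) hψZ t

/-- A predicate on `ℝ^ι` is sign-determined if its truth value at a point depends only on the signs
of finitely many polynomials at that point. -/
def SignDetermined {ι : Type} (S : (ι → ℝ) → Prop) : Prop :=
  ∃ B : Finset (MvPolynomial ι ℝ), ∀ x y : ι → ℝ,
    (∀ b ∈ B, SignType.sign (MvPolynomial.eval x b) = SignType.sign (MvPolynomial.eval y b)) →
    (S x ↔ S y)

/-- Real-valued polynomial functions on `ℝ^ι`. -/
def IsPolyFun {ι : Type} (g : (ι → ℝ) → ℝ) : Prop :=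
  ∃ p : MvPolynomial ι ℝ, ∀ x, g x = MvPolynomial.eval x p

namespace IsPolyFun

variable {ι κ : Type}

theorem const (c : ℝ) : IsPolyFun (fun _ : ι → ℝ => c) := ⟨MvPolynomial.C c, by simp⟩

theorem coord (i : ι) : IsPolyFun (fun x : ι → ℝ => x i) := ⟨MvPolynomial.X i, by simp⟩

theorem add {g h : (ι → ℝ) → ℝ} (hg : IsPolyFun g) (hh : IsPolyFun h) :
    IsPolyFun (fun x => g x + h x) := by
  obtain ⟨p, hp⟩ := hg
  obtain ⟨q, hq⟩ := hh
  exact ⟨p + q, fun x => by simp [hp, hq]⟩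

theorem mul {g h : (ι → ℝ) → ℝ} (hg : IsPolyFun g) (hh : IsPolyFun h) :
    IsPolyFun (fun x => g x * h x) := by
  obtain ⟨p, hp⟩ := hg
  obtain ⟨q, hq⟩ := hh
  exact ⟨p * q, fun x => by simp [hp, hq]⟩

theorem neg {g : (ι → ℝ) → ℝ} (hg : IsPolyFun g) : IsPolyFun (fun x => - g x) := by
  obtain ⟨p, hp⟩ := hg
  exact ⟨-p, fun x => by simp [hp]⟩

theorem sub {g h : (ι → ℝ) → ℝ} (hg : IsPolyFun g) (hh : IsPolyFun h) :
    IsPolyFun (fun x => g x - h x) := by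
  obtain ⟨p, hp⟩ := hg
  obtain ⟨q, hq⟩ := hh
  exact ⟨p - q, fun x => by simp [hp, hq]⟩

theorem pow {g : (ι → ℝ) → ℝ} (hg : IsPolyFun g) (k : ℕ) : IsPolyFun (fun x => g x ^ k) := by
  obtain ⟨p, hp⟩ := hg
  exact ⟨p ^ k, fun x => by simp [hp]⟩

theorem sum {α : Type*} (s : Finset α) {g : α → (ι → ℝ) → ℝ} (hg : ∀ a, IsPolyFun (g a)) :
    IsPolyFun (fun x => ∑ a ∈ s, g a x) := by
  choose p hp using hg
  exact ⟨∑ a ∈ s, p a, fun x => by simp [hp]⟩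

theorem polynomial_eval (h : Polynomial ℝ) {g : (ι → ℝ) → ℝ} (hg : IsPolyFun g) :
    IsPolyFun (fun x => h.eval (g x)) := by
  obtain ⟨p, hp⟩ := hg
  refine ⟨Polynomial.aeval p h, fun x => ?_⟩
  show h.eval (g x) = _
  rw [hp, Polynomial.aeval_def, Polynomial.hom_eval₂, ← Polynomial.eval₂_id]
  congr 1
  ext r
  simp

end IsPolyFun

namespace SignDetermined

variable {ι κ : Type}

theorem not {S : (ι → ℝ) → Prop} (hS : SignDetermined S) : SignDetermined (fun x => ¬ S x) := by
  obtain ⟨B, hB⟩ := hS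
  exact ⟨B, fun x y h => not_congr (hB x y h)⟩

theorem and {S T : (ι → ℝ) → Prop} (hS : SignDetermined S) (hT : SignDetermined T) :
    SignDetermined (fun x => S x ∧ T x) := by
  classical
  obtain ⟨B, hB⟩ := hS
  obtain ⟨B', hB'⟩ := hT
  exact ⟨B ∪ B', fun x y h => and_congr
    (hB x y fun b hb => h b (Finset.mem_union_left _ hb))
    (hB' x y fun b hb => h b (Finset.mem_union_right _ hb))⟩

theorem congr {S T : (ι → ℝ) → Prop} (hS : SignDetermined S) (h : ∀ x, S x ↔ T x) :
    SignDetermined T := by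
  obtain rfl : S = T := funext fun x => propext (h x)
  exact hS

theorem imp {S T : (ι → ℝ) → Prop} (hS : SignDetermined S) (hT : SignDetermined T) :
    SignDetermined (fun x => S x → T x) :=
  (hS.and hT.not).not.congr fun x => by tauto

theorem forall_fintype {α : Type*} [Fintype α] {S : α → (ι → ℝ) → Prop}
    (hS : ∀ a, SignDetermined (S a)) : SignDetermined (fun x => ∀ a, S a x) := by
  classical
  choose B hB using hS
  exact ⟨Finset.univ.biUnion B, fun x y h => forall_congr' fun a => hB a x y fun b hb =>
    h b (Finset.mem_biUnion.2 ⟨a, Finset.mem_univ _, hb⟩)⟩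

theorem le {g h : (ι → ℝ) → ℝ} (hg : IsPolyFun g) (hh : IsPolyFun h) :
    SignDetermined (fun x => g x ≤ h x) := by
  obtain ⟨p, hp⟩ := hh.sub hg
  refine ⟨{p}, fun x y hxy => ?_⟩
  have := hxy p (by simp)
  rw [← hp, ← hp] at this
  show g x ≤ h x ↔ g y ≤ h y
  rw [← sub_nonneg, ← sign_nonneg_iff, this, sign_nonneg_iff, sub_nonneg]

theorem comp {S : (ι → ℝ) → Prop} (hS : SignDetermined S) {g : ι → (κ → ℝ) → ℝ}
    (hg : ∀ i, IsPolyFun (g i)) : SignDetermined (fun v => S (fun i => g i v)) := by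
  classical
  obtain ⟨B, hB⟩ := hS
  choose p hp using hg
  refine ⟨B.image (MvPolynomial.bind₁ p), fun x y h => hB _ _ fun b hb => ?_⟩
  have key : ∀ v : κ → ℝ,
      MvPolynomial.eval (fun i => g i v) b = MvPolynomial.eval v (MvPolynomial.bind₁ p b) := by
    intro v
    simp only [hp]
    exact (MvPolynomial.eval₂Hom_bind₁ (RingHom.id ℝ) v p b).symm
  rw [key, key]
  exact h _ (Finset.mem_image_of_mem _ hb)

/-- Tarski–Seidenberg for one real quantifier. -/
theorem exists_real {S : (Option ι → ℝ) → Prop} (hS : SignDetermined S) :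
    SignDetermined (fun x : ι → ℝ => ∃ t : ℝ, S (fun o => o.elim t x)) := by
  obtain ⟨B, hB⟩ := hS
  let F : MvPolynomial (Option ι) ℝ →ₐ[ℝ] Polynomial (MvPolynomial ι ℝ) :=
    MvPolynomial.aeval (fun o => o.elim Polynomial.X (fun i => Polynomial.C (MvPolynomial.X i)))
  have hF : ∀ (x : ι → ℝ) (t : ℝ) (b : MvPolynomial (Option ι) ℝ),
      ((F b).map (MvPolynomial.eval x)).eval t = MvPolynomial.eval (fun o => o.elim t x) b := by
    intro x t b
    induction b using MvPolynomial.induction_on with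
    | C a => simp [F, Polynomial.algebraMap_apply, MvPolynomial.algebraMap_eq]
    | add p q hp hq => simp [hp, hq]
    | mul_X p o hp =>
      rw [map_mul, Polynomial.map_mul, Polynomial.eval_mul, hp, map_mul]
      cases o <;> simp [F]
  obtain ⟨B', hB'⟩ := exists_finset_sign_diagram (B.val.map F)
  refine ⟨B', fun x y h => ?_⟩
  have key : ∀ x y : ι → ℝ, (∀ b ∈ B', SignType.sign (MvPolynomial.eval x b) =
      SignType.sign (MvPolynomial.eval y b)) → (∃ t : ℝ, S (fun o => o.elim t x)) →
      ∃ t : ℝ, S (fun o => o.elim t y) := by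
    rintro x y h ⟨t, ht⟩
    obtain ⟨φ, hφ⟩ := hB' (MvPolynomial.eval x) (MvPolynomial.eval y) h
    refine ⟨φ t, (hB _ _ fun b hb => ?_).1 ht⟩
    rw [← hF, ← hF]
    exact hφ _ (Multiset.mem_map_of_mem _ hb) t
  exact ⟨key x y h, key y x fun b hb => (h b hb).symm⟩

/-- Tarski–Seidenberg for a finite block of existential quantifiers. -/
theorem exists_fintype [Finite κ] {R : (ι → ℝ) → (κ → ℝ) → Prop}
    (hR : SignDetermined (fun v : ι ⊕ κ → ℝ => R (fun i => v (Sum.inl i)) fun k => v (Sum.inr k))) :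
    SignDetermined (fun x => ∃ y, R x y) := by
  induction κ using Finite.induction_empty_option with
  | of_equiv e ih =>
    rename_i α β
    have := ih (R := fun x y => R x (y ∘ e.symm)) <|
      hR.comp (g := fun s v => v (s.map id e.symm)) fun s => IsPolyFun.coord _
    refine this.congr fun x => ⟨fun ⟨y, hy⟩ => ⟨_, hy⟩, fun ⟨y, hy⟩ => ⟨y ∘ e, ?_⟩⟩
    convert hy
    ext; simp
  | h_empty =>
    refine (hR.comp (κ := ι) (g := fun s x => s.elim x (fun k => k.elim)) ?_).congr ?_
    · rintro (i | k)
      · exact IsPolyFun.coord i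
      · exact k.elim
    · intro x
      refine ⟨fun h => ⟨_, h⟩, fun ⟨y, hy⟩ => ?_⟩
      obtain rfl : y = fun k => k.elim := funext fun k => k.elim
      exact hy
  | h_option ih =>
    rename_i α _
    have := ih (R := fun x y => ∃ t : ℝ, R x (fun o => o.elim t y)) <|
      exists_real (S := fun w : Option (ι ⊕ α) → ℝ => R (fun i => w (some (Sum.inl i)))
        (fun o => o.elim (w none) fun k => w (some (Sum.inr k)))) <|
      (hR.comp (g := fun (s : ι ⊕ Option α) (w : Option (ι ⊕ α) → ℝ) =>
        Sum.elim (fun i => w (some (Sum.inl i)))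
          (fun o : Option α => o.elim (w none) fun k => w (some (Sum.inr k))) s) <| by
        rintro (i | (_ | k)) <;> exact IsPolyFun.coord _)
    refine this.congr fun x => ⟨fun ⟨y, t, h⟩ => ⟨_, h⟩, fun ⟨y, hy⟩ =>
      ⟨fun k => y (some k), y none, ?_⟩⟩
    convert hy with o
    cases o <;> rfl

theorem forall_fintype_fun [Finite κ] {R : (ι → ℝ) → (κ → ℝ) → Prop}
    (hR : SignDetermined (fun v : ι ⊕ κ → ℝ => R (fun i => v (Sum.inl i)) fun k => v (Sum.inr k))) :
    SignDetermined (fun x => ∀ y, R x y) :=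
  (exists_fintype (R := fun x y => ¬ R x y) hR.not).not.congr fun x => by simp

end SignDetermined

theorem IsSemialgebraic.signDetermined {ι : Type} [Fintype ι] {S : Set (ι → ℝ)}
    (hS : IsSemialgebraic S) : SignDetermined (fun x => x ∈ S) := by
  classical
  obtain ⟨N, T, hT, rfl⟩ := hS
  choose p k q hT using hT
  refine ⟨Finset.univ.biUnion fun i => insert (p i) (Finset.univ.image (q i)), fun x y h => ?_⟩
  simp only [Set.mem_iUnion]
  refine exists_congr fun i => ?_
  have hp := h (p i) (Finset.mem_biUnion.2 ⟨i, Finset.mem_univ _, Finset.mem_insert_self _ _⟩)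
  have hq : ∀ j, _ := fun j => h (q i j) (Finset.mem_biUnion.2 ⟨i, Finset.mem_univ _,
    Finset.mem_insert_of_mem (Finset.mem_image_of_mem _ (Finset.mem_univ j))⟩)
  rw [hT i, Set.mem_ofPred_eq, Set.mem_ofPred_eq]
  refine and_congr ?_ (forall_congr' fun j => ?_)
  · rw [← sign_eq_zero_iff, hp, sign_eq_zero_iff]
  · rw [← sign_eq_one_iff, hq j, sign_eq_one_iff]

theorem SignDetermined.isSemialgebraic {ι : Type} [Fintype ι] {S : Set (ι → ℝ)}
    (hS : SignDetermined (fun x => x ∈ S)) : IsSemialgebraic S := by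
  classical
  obtain ⟨B, hB⟩ := hS
  let cell : (B → SignType) → Set (ι → ℝ) :=
    fun σ => {x | ∀ b : B, SignType.sign (MvPolynomial.eval x b.1) = σ b}
  have hcell : ∀ σ, IsBasicSemialgebraic (cell σ) := by
    intro σ
    let e := Fintype.equivFin B
    refine ⟨∑ b : B, if σ b = 0 then b.1 ^ 2 else 0, Fintype.card B,
      fun j => if σ (e.symm j) = 0 then 1 else MvPolynomial.C ((σ (e.symm j) : ℤ) : ℝ) *
        (e.symm j).1, ?_⟩
    ext x
    have h1 : MvPolynomial.eval x (∑ b : B, if σ b = 0 then b.1 ^ 2 else 0) = 0 ↔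
        ∀ b : B, σ b = 0 → MvPolynomial.eval x b.1 = 0 := by
      rw [map_sum, Finset.sum_eq_zero_iff_of_nonneg]
      · refine ⟨fun h b hb => ?_, fun h b _ => ?_⟩
        · simpa [hb] using h b (Finset.mem_univ _)
        · split_ifs with hb
          · simp [h b hb]
          · simp
      · intro b _
        split_ifs
        · rw [map_pow]; positivity
        · simp
    rw [Set.mem_ofPred_eq, Set.mem_ofPred_eq, h1, e.symm.surjective.forall (p := fun b : B =>
      0 < MvPolynomial.eval x (if σ b = 0 then 1 else MvPolynomial.C ((σ b : ℤ) : ℝ) * b.1)) |>.symm,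
      ← forall_and]
    refine forall_congr' fun b => ?_
    rcases h : σ b with _ | _ | _
    · simp
    · simp [sign_eq_neg_one_iff]
    · simp [sign_eq_one_iff]
  let I := {σ : B → SignType // ∃ x ∈ cell σ, x ∈ S}
  let e := Fintype.equivFin I
  refine ⟨Fintype.card I, fun i => cell (e.symm i).1, fun i => hcell _, ?_⟩
  ext x
  rw [Set.mem_iUnion]
  constructor
  · intro hx
    refine ⟨e ⟨fun b => SignType.sign (MvPolynomial.eval x b.1), x, fun b => rfl, hx⟩, ?_⟩
    rw [Equiv.symm_apply_apply]
    exact fun b => rfl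
  · rintro ⟨i, hi⟩
    obtain ⟨y, hy, hyS⟩ := (e.symm i).2
    exact (hB x y fun b hb => (hi ⟨b, hb⟩).trans (hy ⟨b, hb⟩).symm).2 hyS

open Polynomial in
/-- The roots of a bivariate polynomial in its second variable are eventually dominated by a
polynomial in the first variable. -/
theorem exists_polynomial_root_bound (q : ℝ[X][X]) :
    ∃ H : ℝ[X], (∀ r, 0 ≤ H.eval r) ∧ ∀ᶠ r in Filter.atTop,
      q.map (evalRingHom r) = 0 ∨ ∀ s, H.eval r ≤ s → (q.map (evalRingHom r)).eval s ≠ 0 := by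
  by_cases hq : q = 0
  · exact ⟨0, by simp, by simp [hq]⟩
  set a := q.leadingCoeff with ha
  have ha0 : a ≠ 0 := leadingCoeff_ne_zero.2 hq
  obtain ⟨c, hc, hac⟩ : ∃ c > 0, ∀ᶠ r in Filter.atTop, c ≤ |a.eval r| := by
    by_cases hdeg : a.degree ≤ 0
    · rw [eq_C_of_degree_le_zero hdeg] at ha0 ⊢
      refine ⟨|a.coeff 0|, abs_pos.2 (by simpa using ha0), by simp⟩
    · exact ⟨1, one_pos, (Polynomial.abs_tendsto_atTop a (not_le.1 hdeg)).eventually_ge_atTop 1⟩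
  have hsum : ∀ r, 0 ≤ ∑ j ∈ Finset.range q.natDegree, (1 + (q.coeff j).eval r ^ 2) :=
    fun r => Finset.sum_nonneg fun j _ => by positivity
  have hH : ∀ r, (1 + C c⁻¹ * ∑ j ∈ Finset.range q.natDegree, (1 + q.coeff j ^ 2)).eval r =
      1 + c⁻¹ * ∑ j ∈ Finset.range q.natDegree, (1 + (q.coeff j).eval r ^ 2) := by
    intro r; simp [eval_finsetSum]
  refine ⟨1 + C c⁻¹ * ∑ j ∈ Finset.range q.natDegree, (1 + q.coeff j ^ 2), fun r => ?_, ?_⟩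
  · rw [hH]
    have := mul_nonneg (inv_pos.2 hc).le (hsum r)
    linarith
  · filter_upwards [hac] with r hr
    refine Or.inr fun s hs h0 => ?_
    rw [hH] at hs
    have hs1 : 1 ≤ s := by
      have := mul_nonneg (inv_pos.2 hc).le (hsum r)
      linarith
    have har : evalRingHom r q.leadingCoeff ≠ 0 := by
      rw [coe_evalRingHom]
      exact abs_pos.1 (hc.trans_le hr)
    rw [eval_eq_sum_range, natDegree_map_of_leadingCoeff_ne_zero _ har, Finset.sum_range_succ] at h0
    simp only [coeff_map, coe_evalRingHom, coeff_natDegree] at h0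
    rw [← ha] at h0
    set d := q.natDegree with hd
    have h1 : |a.eval r| * s ^ d ≤ ∑ j ∈ Finset.range d, |(q.coeff j).eval r| * s ^ j := by
      have : |a.eval r| * s ^ d = |∑ j ∈ Finset.range d, (q.coeff j).eval r * s ^ j| := by
        rw [eq_neg_of_add_eq_zero_left h0, abs_neg, abs_mul, abs_of_nonneg (a := s ^ d)
          (by positivity)]
      rw [this]
      refine (Finset.abs_sum_le_sum_abs _ _).trans_eq (Finset.sum_congr rfl fun j _ => ?_)
      rw [abs_mul, abs_of_nonneg (a := s ^ j) (by positivity)]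
    have h2 : (∑ j ∈ Finset.range d, |(q.coeff j).eval r| * s ^ j) * s ≤
        (∑ j ∈ Finset.range d, (1 + (q.coeff j).eval r ^ 2)) * s ^ d := by
      rw [Finset.sum_mul, Finset.sum_mul]
      refine Finset.sum_le_sum fun j hj => ?_
      rw [mul_assoc, ← pow_succ]
      have e1 : |(q.coeff j).eval r| ≤ 1 + (q.coeff j).eval r ^ 2 := by
        rw [abs_le]; constructor <;> nlinarith [sq_nonneg ((q.coeff j).eval r + 1),
          sq_nonneg ((q.coeff j).eval r - 1)]
      have e2 : s ^ (j + 1) ≤ s ^ d := pow_le_pow_right₀ hs1 (Finset.mem_range.1 hj)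
      gcongr
    have h3 : c * s ≤ ∑ j ∈ Finset.range d, (1 + (q.coeff j).eval r ^ 2) := by
      have hsd : 0 < s ^ d := by positivity
      refine le_of_mul_le_mul_right ?_ hsd
      have : c * s * s ^ d ≤ |a.eval r| * s ^ d * s := by
        rw [mul_assoc, mul_comm s, ← mul_assoc]
        gcongr
      exact this.trans ((mul_le_mul_of_nonneg_right h1 (by linarith)).trans h2)
    have h4 : c * (1 + c⁻¹ * ∑ j ∈ Finset.range d, (1 + (q.coeff j).eval r ^ 2)) ≤ c * s :=
      mul_le_mul_of_nonneg_left hs hc.le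
    rw [mul_add, mul_inv_cancel_left₀ hc.ne'] at h4
    linarith

open Polynomial in
/-- Far away in the first variable and above a polynomial in the first variable, the sign of a
bivariate polynomial does not depend on the second variable. -/
theorem exists_polynomial_sign_eq (b : MvPolynomial (Fin 2) ℝ) :
    ∃ H : ℝ[X], (∀ r, 0 ≤ H.eval r) ∧ ∀ᶠ r in Filter.atTop, ∀ s s', H.eval r ≤ s → s ≤ s' →
      SignType.sign (MvPolynomial.eval ![r, s] b) =
        SignType.sign (MvPolynomial.eval ![r, s'] b) := by
  let F : MvPolynomial (Fin 2) ℝ →ₐ[ℝ] ℝ[X][X] := MvPolynomial.aeval ![C X, X]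
  have hF : ∀ r s, ((F b).map (evalRingHom r)).eval s = MvPolynomial.eval ![r, s] b := by
    intro r s
    induction b using MvPolynomial.induction_on with
    | C a => simp [F, Polynomial.algebraMap_apply]
    | add p q hp hq => simp [hp, hq]
    | mul_X p i hp =>
      rw [map_mul, Polynomial.map_mul, eval_mul, hp, map_mul]
      fin_cases i <;> simp [F]
  obtain ⟨H, hH0, hH⟩ := exists_polynomial_root_bound (F b)
  refine ⟨H, hH0, ?_⟩
  filter_upwards [hH] with r hr s s' hs hss'
  rw [← hF, ← hF]
  rcases hr with hr | hr
  · simp [hr]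
  · apply sign_eq_of_mul_pos
    apply eval_mul_eval_pos_of_forall_ne_zero
    intro w hw
    rw [Set.uIcc_of_le hss'] at hw
    exact hr w (hs.trans hw.1)

/-- A semialgebraic function which is bounded on compact sets has polynomial growth. -/
theorem IsSemialgebraicFun.exists_polynomial_growth {n : ℕ} {f : (Fin n → ℝ) → ℝ}
    (hsa : IsSemialgebraicFun f)
    (hcb : ∀ C : Set (Fin n → ℝ), IsCompact C → ∃ K : ℝ, ∀ x ∈ C, |f x| ≤ K) :
    ∃ h : Polynomial ℝ, (∀ r, 0 < h.eval r) ∧ ∀ x, |f x| ≤ h.eval (∑ i, x i ^ 2) := by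
  have hD : SignDetermined (fun v : Fin 2 → ℝ => ∀ (x : Fin n → ℝ) (τ : Unit → ℝ),
      f x = τ () → ∑ i, x i ^ 2 ≤ v 0 → - v 1 ≤ τ () ∧ τ () ≤ v 1) := by
    apply SignDetermined.forall_fintype_fun
    apply SignDetermined.forall_fintype_fun
    refine SignDetermined.imp ?_ (SignDetermined.imp ?_ (SignDetermined.and ?_ ?_))
    · exact hsa.signDetermined.comp (g := fun s (v : (Fin 2 ⊕ Fin n) ⊕ Unit → ℝ) =>
        v (s.map Sum.inr id)) fun s => IsPolyFun.coord _
    · exact SignDetermined.le (IsPolyFun.sum _ fun i => (IsPolyFun.coord _).pow 2)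
        (IsPolyFun.coord _)
    · exact SignDetermined.le (IsPolyFun.coord _).neg (IsPolyFun.coord _)
    · exact SignDetermined.le (IsPolyFun.coord _) (IsPolyFun.coord _)
  replace hD : SignDetermined (fun v : Fin 2 → ℝ => ∀ x : Fin n → ℝ,
      ∑ i, x i ^ 2 ≤ v 0 → |f x| ≤ v 1) :=
    hD.congr fun v => forall_congr' fun x =>
      ⟨fun h h1 => abs_le.2 (h (fun _ => f x) rfl h1), fun h τ hτ h1 => hτ ▸ abs_le.1 (h h1)⟩
  obtain ⟨B, hB⟩ := hD
  choose H hH0 hH using exists_polynomial_sign_eq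
  obtain ⟨r₀, hr₀⟩ := Filter.eventually_atTop.1
    ((Filter.eventually_all_finset B).2 fun b _ => hH b)
  have hK : ∀ R : ℝ, ∃ K : ℝ, ∀ x : Fin n → ℝ, ∑ i, x i ^ 2 ≤ R → |f x| ≤ K := by
    intro R
    refine hcb {x | ∑ i, x i ^ 2 ≤ R} (Metric.isCompact_of_isClosed_isBounded ?_ ?_)
    · exact isClosed_le (by fun_prop) continuous_const
    · refine (Metric.isBounded_closedBall (x := (0 : Fin n → ℝ)) (r := 1 + R)).subset ?_
      intro x hx
      have hx : ∑ i, x i ^ 2 ≤ R := hx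
      have h0 : 0 ≤ ∑ i, x i ^ 2 := Finset.sum_nonneg fun i _ => sq_nonneg _
      rw [mem_closedBall_zero_iff, pi_norm_le_iff_of_nonneg (by linarith)]
      intro i
      have : x i ^ 2 ≤ ∑ i, x i ^ 2 :=
        Finset.single_le_sum (f := fun i => x i ^ 2) (fun i _ => sq_nonneg _) (Finset.mem_univ i)
      rw [Real.norm_eq_abs, abs_le]
      constructor <;> nlinarith
  choose K hK using hK
  have hsum : ∀ r, (∑ b ∈ B, H b).eval r = ∑ b ∈ B, (H b).eval r := fun r => by
    rw [Polynomial.eval_finsetSum]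
  have hsum0 : ∀ r, 0 ≤ (∑ b ∈ B, H b).eval r := fun r => by
    rw [hsum]
    exact Finset.sum_nonneg fun b _ => hH0 b r
  refine ⟨(∑ b ∈ B, H b) + Polynomial.C (|K r₀| + 1), fun r => ?_, fun x => ?_⟩
  · rw [Polynomial.eval_add, Polynomial.eval_C]
    have := hsum0 r
    positivity
  · rw [Polynomial.eval_add, Polynomial.eval_C]
    set r := ∑ i, x i ^ 2 with hr
    rcases le_total r₀ r with hle | hle
    · set s := (∑ b ∈ B, H b).eval r with hs
      have h1 := (hB ![r, s] ![r, max s (K r)] fun b hb =>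
        hr₀ r hle b hb s _ (by
          rw [hs, hsum]
          exact Finset.single_le_sum (f := fun b => (H b).eval r) (fun b _ => hH0 b r) hb)
          (le_max_left _ _)).2 (fun y hy => (hK r y hy).trans (le_max_right _ _)) x le_rfl
      have h1 : |f x| ≤ s := h1
      have := abs_nonneg (K r₀)
      linarith
    · have h1 := hK r₀ x hle
      have h2 := hsum0 r
      have := le_abs_self (K r₀)
      linarith

/-- Numerators of the coordinates of the compactification `x ↦ (1, x) / (1 + ∑ i, x i ^ 2)`. -/
def compactNum {n : ℕ} (x : Fin n → ℝ) : Fin (n + 1) → ℝ := Fin.cons 1 x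

/-- The denominator of the compactification `x ↦ (1, x) / (1 + ∑ i, x i ^ 2)`. -/
def compactDen {n : ℕ} (x : Fin n → ℝ) : ℝ := 1 + ∑ i, x i ^ 2

/-- The closed convex hull of the epigraph, truncated to the unit box, of `f / h` transported by
the compactification `x ↦ (1, x) / (1 + ∑ i, x i ^ 2)`: the points of the box satisfying all
affine inequalities valid on the graph. -/
def compactHull {n : ℕ} (f h : (Fin n → ℝ) → ℝ) : Set (Fin (n + 2) → ℝ) :=
  {y | (∀ i, -1 ≤ y i ∧ y i ≤ 1) ∧ ∀ A : Fin (n + 2) → ℝ,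
    (∀ x, (∑ i, A (Fin.castSucc i) * compactNum x i + A (Fin.last _) * compactDen x) * h x ≤
      f x * compactDen x) →
    ∑ i : Fin (n + 1), A (Fin.castSucc i) * y (Fin.castSucc i) + A (Fin.last _) ≤ y (Fin.last _)}

theorem compactDen_pos {n : ℕ} (x : Fin n → ℝ) : 0 < compactDen x := by
  unfold compactDen
  positivity

theorem abs_compactNum_le {n : ℕ} (x : Fin n → ℝ) (i : Fin (n + 1)) :
    |compactNum x i| ≤ compactDen x := by
  unfold compactNum compactDen
  refine Fin.cases ?_ (fun j => ?_) i
  · have : 0 ≤ ∑ i, x i ^ 2 := Finset.sum_nonneg fun i _ => sq_nonneg _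
    simpa using this
  · have : x j ^ 2 ≤ ∑ i, x i ^ 2 :=
      Finset.single_le_sum (f := fun i => x i ^ 2) (fun i _ => sq_nonneg _) (Finset.mem_univ j)
    rw [Fin.cons_succ, abs_le]
    constructor <;> nlinarith [sq_nonneg (x j + 1), sq_nonneg (x j - 1)]

theorem isClosed_compactHull {n : ℕ} (f h : (Fin n → ℝ) → ℝ) : IsClosed (compactHull f h) := by
  have : compactHull f h = (⋂ i, {y | -1 ≤ y i ∧ y i ≤ 1}) ∩
      ⋂ (A : Fin (n + 2) → ℝ) (_ : ∀ x, (∑ i, A (Fin.castSucc i) * compactNum x i +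
        A (Fin.last _) * compactDen x) * h x ≤ f x * compactDen x),
      {y : Fin (n + 2) → ℝ | ∑ i : Fin (n + 1), A (Fin.castSucc i) * y (Fin.castSucc i) +
        A (Fin.last _) ≤ y (Fin.last _)} := by
    ext y
    simp [compactHull]
  rw [this]
  refine IsClosed.inter (isClosed_iInter fun i => ?_)
    (isClosed_iInter fun A => isClosed_iInter fun _ => isClosed_le (by fun_prop) (by fun_prop))
  exact isClosed_Icc.preimage (continuous_apply i)

theorem isCompact_compactHull {n : ℕ} (f h : (Fin n → ℝ) → ℝ) : IsCompact (compactHull f h) :=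
  (isCompact_Icc (a := (-1 : Fin (n + 2) → ℝ)) (b := 1)).of_isClosed_subset
    (isClosed_compactHull f h) fun _ hy => ⟨fun i => (hy.1 i).1, fun i => (hy.1 i).2⟩

theorem convex_compactHull {n : ℕ} (f h : (Fin n → ℝ) → ℝ) : Convex ℝ (compactHull f h) := by
  intro y hy z hz a b ha hb hab
  refine ⟨fun i => ?_, fun A hA => ?_⟩
  · have h1 := hy.1 i
    have h2 := hz.1 i
    simp only [Pi.add_apply, Pi.smul_apply, smul_eq_mul]
    constructor <;> nlinarith
  · have h1 := mul_le_mul_of_nonneg_left (hy.2 A hA) ha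
    have h2 := mul_le_mul_of_nonneg_left (hz.2 A hA) hb
    have h3 : ∑ i : Fin (n + 1), A (Fin.castSucc i) * (a • y + b • z) (Fin.castSucc i) =
        a * ∑ i : Fin (n + 1), A (Fin.castSucc i) * y (Fin.castSucc i) +
        b * ∑ i : Fin (n + 1), A (Fin.castSucc i) * z (Fin.castSucc i) := by
      rw [Finset.mul_sum, Finset.mul_sum, ← Finset.sum_add_distrib]
      refine Finset.sum_congr rfl fun i _ => ?_
      simp only [Pi.add_apply, Pi.smul_apply, smul_eq_mul]
      ring
    rw [h3]
    simp only [Pi.add_apply, Pi.smul_apply, smul_eq_mul]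
    have h4 : A (Fin.last _) = a * A (Fin.last _) + b * A (Fin.last _) := by
      rw [← add_mul, hab, one_mul]
    linarith

theorem snoc_mem_compactHull {n : ℕ} {f h : (Fin n → ℝ) → ℝ} (hpos : ∀ x, 0 < h x)
    (hle : ∀ x, |f x| ≤ h x) (x : Fin n → ℝ) :
    (Fin.snoc (fun i => compactNum x i / compactDen x) (f x / h x) : Fin (n + 2) → ℝ) ∈
      compactHull f h := by
  have hN := compactDen_pos x
  refine ⟨fun i => ?_, fun A hA => ?_⟩
  · rw [← abs_le]
    refine Fin.lastCases ?_ (fun j => ?_) i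
    · rw [Fin.snoc_last, abs_div, abs_of_pos (hpos x), div_le_one (hpos x)]
      exact hle x
    · rw [Fin.snoc_castSucc, abs_div, abs_of_pos hN, div_le_one hN]
      exact abs_compactNum_le x j
  · simp only [Fin.snoc_castSucc, Fin.snoc_last, ← mul_div_assoc]
    rw [← Finset.sum_div, le_div_iff₀ (hpos x), div_add' _ _ _ hN.ne', div_mul_eq_mul_div,
      div_le_iff₀ hN]
    exact hA x

theorem IsPolyFun.compactNum {ι : Type} {n : ℕ} {g : Fin n → (ι → ℝ) → ℝ}
    (hg : ∀ i, IsPolyFun (g i)) (i : Fin (n + 1)) :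
    IsPolyFun (fun v => compactNum (fun j => g j v) i) := by
  refine Fin.cases ?_ (fun j => ?_) i
  · exact .const 1
  · exact hg j

theorem IsPolyFun.compactDen {ι : Type} {n : ℕ} {g : Fin n → (ι → ℝ) → ℝ}
    (hg : ∀ i, IsPolyFun (g i)) : IsPolyFun (fun v => compactDen (fun j => g j v)) :=
  (IsPolyFun.const 1).add (.sum _ fun i => (hg i).pow 2)

theorem isSemialgebraic_compactHull {n : ℕ} {f : (Fin n → ℝ) → ℝ} (hsa : IsSemialgebraicFun f)
    (h : Polynomial ℝ) : IsSemialgebraic (compactHull f fun x => h.eval (∑ i, x i ^ 2)) := by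
  apply SignDetermined.isSemialgebraic
  refine SignDetermined.and (SignDetermined.forall_fintype fun i => SignDetermined.and
    (.le (.const _) (.coord _)) (.le (.coord _) (.const _))) ?_
  apply SignDetermined.forall_fintype_fun
  refine SignDetermined.imp ?_ (.le (.add (.sum _ fun i => .mul (.coord _) (.coord _)) (.coord _))
    (.coord _))
  apply SignDetermined.forall_fintype_fun
  have : SignDetermined (fun v : (((Fin (n + 2) ⊕ Fin (n + 2)) ⊕ Fin n) → ℝ) =>
      ∀ τ : Unit → ℝ, f (fun k => v (Sum.inr k)) = τ () →
      (∑ i : Fin (n + 1), v (Sum.inl (Sum.inr (Fin.castSucc i))) *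
          compactNum (fun k => v (Sum.inr k)) i +
        v (Sum.inl (Sum.inr (Fin.last _))) * compactDen (fun k => v (Sum.inr k))) *
          h.eval (∑ i, v (Sum.inr i) ^ 2) ≤ τ () * compactDen (fun k => v (Sum.inr k))) := by
    apply SignDetermined.forall_fintype_fun
    refine SignDetermined.imp ?_ (.le (.mul (.add (.sum _ fun i => .mul (.coord _)
      (.compactNum (fun j => .coord _) i)) (.mul (.coord _) (.compactDen fun j => .coord _)))
      (.polynomial_eval h (.sum _ fun i => .pow (.coord _) 2)))
      (.mul (.coord _) (.compactDen fun j => .coord _)))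
    exact hsa.signDetermined.comp
      (g := fun s (v : ((Fin (n + 2) ⊕ Fin (n + 2)) ⊕ Fin n) ⊕ Unit → ℝ) =>
        v (s.map Sum.inr id)) fun s => IsPolyFun.coord _
  exact this.congr fun v => ⟨fun H => H (fun _ => f _) rfl, fun H τ hτ => hτ ▸ H⟩

/-- A lower semicontinuous function of controlled growth is approached at each point by affine
minorants in the coordinates of the compactification. -/
theorem LowerSemicontinuous.exists_compact_minorant {n : ℕ} {f h : (Fin n → ℝ) → ℝ}
    (hlsc : LowerSemicontinuous f) (hcont : Continuous h) (hpos : ∀ x, 0 < h x)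
    (hle : ∀ x, |f x| ≤ h x) (x₀ : Fin n → ℝ) {ε : ℝ} (hε : 0 < ε) :
    ∃ A : Fin (n + 2) → ℝ,
      (∀ x, (∑ i, A (Fin.castSucc i) * compactNum x i + A (Fin.last _) * compactDen x) * h x ≤
        f x * compactDen x) ∧
      ∑ i, A (Fin.castSucc i) * compactNum x₀ i + A (Fin.last _) * compactDen x₀ =
        (f x₀ / h x₀ - ε) * compactDen x₀ := by
  set c := f x₀ / h x₀ - ε with hc
  have hc1 : c ≤ 1 := by
    have := (div_le_one (hpos x₀)).2 ((le_abs_self _).trans (hle x₀))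
    linarith
  obtain ⟨η, hη, hball⟩ : ∃ η > 0, ∀ x, dist x x₀ < η → c * h x ≤ f x := by
    have h1 : LowerSemicontinuous fun x => f x + (-(c * h x)) :=
      hlsc.add (by fun_prop : Continuous fun x => -(c * h x)).lowerSemicontinuous
    have h2 : 0 < f x₀ + (-(c * h x₀)) := by
      rw [hc, sub_mul, div_mul_cancel₀ _ (hpos x₀).ne']
      have := mul_pos hε (hpos x₀)
      linarith
    obtain ⟨η, hη, H⟩ := Metric.eventually_nhds_iff.1 (h1 x₀ 0 h2)
    exact ⟨η, hη, fun x hx => by linarith [H hx]⟩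
  set R := ∑ i, x₀ i ^ 2 with hR
  have hR0 : 0 ≤ R := Finset.sum_nonneg fun i _ => sq_nonneg _
  set M := 2 * ((1 + 2 * R) / η ^ 2 + 2) with hM
  have hM0 : 0 ≤ M := by positivity
  set A : Fin (n + 2) → ℝ :=
    Fin.snoc (Fin.cons (M * (1 - R)) (fun i => 2 * M * x₀ i) : Fin (n + 1) → ℝ) (c - M) with hA
  have hval : ∀ x, ∑ i, A (Fin.castSucc i) * compactNum x i + A (Fin.last _) * compactDen x =
      c * compactDen x - M * ∑ i, (x i - x₀ i) ^ 2 := by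
    intro x
    have e : ∑ i, (x i - x₀ i) ^ 2 = ∑ i, x i ^ 2 - 2 * ∑ i, x₀ i * x i + R := by
      rw [hR, Finset.mul_sum, ← Finset.sum_sub_distrib, ← Finset.sum_add_distrib]
      exact Finset.sum_congr rfl fun i _ => by ring
    have e2 : ∑ i, 2 * M * x₀ i * x i = 2 * M * ∑ i, x₀ i * x i := by
      rw [Finset.mul_sum]
      exact Finset.sum_congr rfl fun i _ => by ring
    rw [e]
    simp only [hA, Fin.snoc_castSucc, Fin.snoc_last, compactNum, compactDen, Fin.sum_univ_succ,
      Fin.cons_zero, Fin.cons_succ]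
    rw [e2]
    ring
  refine ⟨A, fun x => ?_, by simp [hval]⟩
  rw [hval]
  set D := ∑ i, (x i - x₀ i) ^ 2 with hD
  have hD0 : 0 ≤ D := Finset.sum_nonneg fun i _ => sq_nonneg _
  have hN := compactDen_pos x
  by_cases hx : dist x x₀ < η
  · have h1 := mul_le_mul_of_nonneg_right (hball x hx) hN.le
    have h2 : 0 ≤ M * D * h x := mul_nonneg (mul_nonneg hM0 hD0) (hpos x).le
    nlinarith
  · have hDη : η ^ 2 ≤ D := by
      by_contra! hlt
      refine hx ((dist_pi_lt_iff hη).2 fun i => ?_)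
      have h1 : (x i - x₀ i) ^ 2 ≤ D := Finset.single_le_sum
        (f := fun i => (x i - x₀ i) ^ 2) (fun i _ => sq_nonneg _) (Finset.mem_univ i)
      rw [Real.dist_eq]
      exact abs_lt_of_sq_lt_sq (h1.trans_lt hlt) hη.le
    have h1 : compactDen x ≤ 1 + 2 * R + 2 * D := by
      have : ∑ i, x i ^ 2 ≤ ∑ i, (2 * x₀ i ^ 2 + 2 * (x i - x₀ i) ^ 2) :=
        Finset.sum_le_sum fun i _ => by nlinarith [sq_nonneg (x i - 2 * x₀ i)]
      rw [Finset.sum_add_distrib, ← Finset.mul_sum, ← Finset.mul_sum] at this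
      unfold compactDen
      linarith
    have h2 : 1 + 2 * R ≤ (1 + 2 * R) / η ^ 2 * D := by
      rw [div_mul_eq_mul_div, le_div_iff₀ (by positivity)]
      gcongr
    have h3 : 2 * compactDen x ≤ M * D := by
      rw [hM]
      nlinarith
    have h4 : c * compactDen x - M * D ≤ - compactDen x := by nlinarith
    have h5 := mul_le_mul_of_nonneg_right h4 (hpos x).le
    have h6 := mul_le_mul_of_nonneg_right (neg_le_of_abs_le (hle x)) hN.le
    linarith

theorem le_of_mem_compactHull {n : ℕ} {f h : (Fin n → ℝ) → ℝ}
    (hlsc : LowerSemicontinuous f) (hcont : Continuous h) (hpos : ∀ x, 0 < h x)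
    (hle : ∀ x, |f x| ≤ h x) {x : Fin n → ℝ} {y : Fin (n + 2) → ℝ} (hy : y ∈ compactHull f h)
    (hyx : ∀ i, y (Fin.castSucc i) = compactNum x i / compactDen x) :
    f x ≤ h x * y (Fin.last _) := by
  rw [mul_comm, ← div_le_iff₀ (hpos x)]
  refine le_of_forall_pos_sub_le fun ε hε => ?_
  obtain ⟨A, hA, hAx⟩ := hlsc.exists_compact_minorant hcont hpos hle x hε
  have h1 := hy.2 A hA
  have hN := compactDen_pos x
  simp only [hyx, ← mul_div_assoc] at h1
  rwa [← Finset.sum_div, div_add' _ _ _ hN.ne', hAx, mul_div_cancel_right₀ _ hN.ne'] at h1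

theorem IsPolyFun.isPolyMap {n m : ℕ} {P : (Fin n → ℝ) → (Fin m → ℝ) → ℝ}
    (hP : IsPolyFun fun v : Fin n ⊕ Fin m → ℝ =>
      P (fun i => v (Sum.inl i)) fun i => v (Sum.inr i)) : IsPolyMap P := by
  obtain ⟨p, hp⟩ := hP
  exact ⟨p, fun x y => hp (Sum.elim x y)⟩

theorem convexOn_sum_sq_mul_sub {n : ℕ} (N : ℝ) (Z : Fin (n + 1) → ℝ) :
    ConvexOn ℝ Set.univ fun y : Fin (n + 2) → ℝ =>
      ∑ i, (N * y (Fin.castSucc i) - Z i) ^ 2 := by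
  refine ⟨convex_univ, fun y _ z _ a b ha hb hab => ?_⟩
  simp only [smul_eq_mul]
  rw [Finset.mul_sum, Finset.mul_sum, ← Finset.sum_add_distrib]
  refine Finset.sum_le_sum fun i _ => ?_
  have := (even_two.convexOn_pow (𝕜 := ℝ)).2 (mem_univ (N * y (Fin.castSucc i) - Z i))
    (mem_univ (N * z (Fin.castSucc i) - Z i)) ha hb hab
  simp only [smul_eq_mul] at this
  convert this using 2
  simp only [Pi.add_apply, Pi.smul_apply, smul_eq_mul]
  linear_combination Z i * hab

/-- every semi-algebraic, lower semicontinuous function bounded on compact sets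
is the optimistic value function of a polynomial bilevel problem with convex lower-level
objective over a nonempty compact convex semi-algebraic set. -/
theorem sa_lsc_cb_is_compact_convex_optimistic_value (n : ℕ) (f : (Fin n → ℝ) → ℝ)
    (hsa : IsSemialgebraicFun f) (hlsc : LowerSemicontinuous f)
    (hcb : ∀ C : Set (Fin n → ℝ), IsCompact C → ∃ K : ℝ, ∀ x ∈ C, |f x| ≤ K) :
    ∃ (m : ℕ) (P Q : (Fin n → ℝ) → (Fin m → ℝ) → ℝ) (Y : Set (Fin m → ℝ)),
      IsPolyMap P ∧ IsPolyMap Q ∧ (∀ x, ConvexOn ℝ Set.univ (Q x)) ∧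
      Y.Nonempty ∧ IsCompact Y ∧ Convex ℝ Y ∧ IsSemialgebraic Y ∧
      ∀ x, valOpt P Q Y x = ((f x : ℝ) : EReal) := by
  obtain ⟨h, hpos, hle⟩ := hsa.exists_polynomial_growth hcb
  have hcont : Continuous fun x : Fin n → ℝ => h.eval (∑ i, x i ^ 2) :=
    h.continuous.comp (by fun_prop)
  have hmem := snoc_mem_compactHull (fun x => hpos _) hle
  refine ⟨n + 2, fun x y => h.eval (∑ i, x i ^ 2) * y (Fin.last _),
    fun x y => ∑ i, (compactDen x * y (Fin.castSucc i) - compactNum x i) ^ 2,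
    compactHull f fun x => h.eval (∑ i, x i ^ 2), ?_, ?_,
    fun x => convexOn_sum_sq_mul_sub _ _, ⟨_, hmem 0⟩, isCompact_compactHull _ _,
    convex_compactHull _ _, isSemialgebraic_compactHull hsa h, fun x => ?_⟩
  · exact IsPolyFun.isPolyMap (.mul (.polynomial_eval h (.sum _ fun i => .pow (.coord _) 2))
      (.coord _))
  · exact IsPolyFun.isPolyMap (.sum _ fun i => .pow (.sub (.mul (.compactDen fun j => .coord _)
      (.coord _)) (.compactNum (fun j => .coord _) i)) 2)
  have hN := compactDen_pos x
  set z : Fin (n + 2) → ℝ :=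
    Fin.snoc (fun i => compactNum x i / compactDen x) (f x / h.eval (∑ i, x i ^ 2)) with hz
  have hQ : ∑ i, (compactDen x * z (Fin.castSucc i) - compactNum x i) ^ 2 = 0 := by
    refine Finset.sum_eq_zero fun i _ => ?_
    rw [hz, Fin.snoc_castSucc, mul_div_cancel₀ _ hN.ne', sub_self, sq, zero_mul]
  apply le_antisymm
  · refine (iInf₂_le _ ⟨hmem x, fun y' _ => ?_⟩).trans_eq ?_
    · show ((h.eval (∑ i, x i ^ 2) * z (Fin.last _) : ℝ) : EReal) = f x
      rw [hz, Fin.snoc_last, mul_div_cancel₀ _ (hpos _).ne']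
    · exact hQ.trans_le (Finset.sum_nonneg fun i _ => sq_nonneg (_ * y' _ - _))
  · refine le_iInf₂ fun y hy => EReal.coe_le_coe_iff.2 ?_
    refine le_of_mem_compactHull hlsc hcont (fun x => hpos _) hle hy.1 fun i => ?_
    have h2 : ∑ i : Fin (n + 1), (compactDen x * y (Fin.castSucc i) - compactNum x i) ^ 2 ≤ 0 :=
      (hy.2 _ (hmem x)).trans_eq hQ
    have h3 := (Finset.sum_eq_zero_iff_of_nonneg fun i _ => sq_nonneg _).1
      (h2.antisymm (Finset.sum_nonneg fun i _ => sq_nonneg _)) i (Finset.mem_univ i)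
    rw [eq_div_iff hN.ne', mul_comm]
    exact sub_eq_zero.1 (pow_eq_zero_iff two_ne_zero |>.1 h3)
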